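/- For every constant C > 0 there exists δ > 0 such that the gradient ∇ρ(p) of the function ρ(x,u,y,v) = x² − yv² + (9/4)u² − y³ + C(xy − (3/2)uv) does not vanish for any p ∈ ℝ⁴ with 0 < |p| < δ; consequently M = {ρ = 0} is a smooth hypersurface in a punctured neighborhood of the origin. -/

import Mathlib

noncomputable section

/-- The defining function `ρ(x,u,y,v) = x² − yv² + (9/4)u² − y³ + C(xy − (3/2)uv)`
of the auxiliary hypersurface `M`. -/
def rho (C : ℝ) (p : Fin 4 → ℝ) : ℝ :=
  p 0 ^ 2 - p 2 * p 3 ^ 2 + 9 / 4 * p 1 ^ 2 - p 2 ^ 3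
    + C * (p 0 * p 2 - 3 / 2 * p 1 * p 3)

/-- The derivative of `rho C` at `p`, applied to a vector `w`. -/
lemma fderiv_rho_apply (C : ℝ) (p w : Fin 4 → ℝ) :
    fderiv ℝ (rho C) p w =
      (2 * p 0 + C * p 2) * w 0 + (9 / 2 * p 1 - 3 / 2 * C * p 3) * w 1
        + (C * p 0 - p 3 ^ 2 - 3 * p 2 ^ 2) * w 2
        - (2 * p 2 * p 3 + 3 / 2 * C * p 1) * w 3 := by
  have h (i : Fin 4) := hasFDerivAt_apply (𝕜 := ℝ) i p
  have hrho := (((((h 0).pow 2).sub ((h 2).mul ((h 3).pow 2))).add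
    (((h 1).pow 2).const_mul (9 / 4))).sub ((h 2).pow 3)).add
    ((((h 0).mul (h 2)).sub (((h 1).const_mul (3 / 2)).mul (h 3))).const_mul C)
  have hfderiv : fderiv ℝ (rho C) p = _ := hrho.fderiv
  rw [hfderiv]
  simp
  ring

/-- For every `C > 0` there is `δ > 0` such that the gradient of `ρ` does not vanish
at any point `p` with `0 < |p| < δ`; hence `M = {ρ = 0}` is a smooth hypersurface in a
punctured neighbourhood of the origin. -/
theorem rho_gradient_nonvanishing :
    ∀ C : ℝ, 0 < C → ∃ δ > 0, ∀ p : Fin 4 → ℝ,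
      0 < ‖p‖ → ‖p‖ < δ → fderiv ℝ (rho C) p ≠ 0 := by
  intro C hC
  refine ⟨C ^ 2 / 8, by positivity, fun p hp hpδ h => ?_⟩
  have hgrad (w : Fin 4 → ℝ) := fderiv_rho_apply C p w
  rw [h] at hgrad
  have h0 : 2 * p 0 + C * p 2 = 0 := by
    simpa using (hgrad (Pi.single 0 1)).symm
  have h1 : 9 / 2 * p 1 - 3 / 2 * C * p 3 = 0 := by
    simpa using (hgrad (Pi.single 1 1)).symm
  have h2 : C * p 0 - p 3 ^ 2 - 3 * p 2 ^ 2 = 0 := by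
    simpa using (hgrad (Pi.single 2 1)).symm
  have h3 : -(2 * p 2 * p 3 + 3 / 2 * C * p 1) = 0 := by
    simpa using (hgrad (Pi.single 3 1)).symm
  have hy : -(C ^ 2 / 8) < p 2 :=
    (abs_lt.mp ((norm_le_pi_norm p 2).trans_lt hpδ)).1
  have hC2 : 0 < C ^ 2 := by positivity
  have hv : p 3 = 0 := by
    have hmul : p 3 * (2 * p 2 + C ^ 2 / 2) = 0 := by
      linear_combination -h3 - C / 3 * h1
    exact (mul_eq_zero.mp hmul).resolve_right (by linarith)
  have hy0 : p 2 = 0 := by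
    have hmul : p 2 * (3 * p 2 + C ^ 2 / 2) = 0 := by
      linear_combination C / 2 * h0 - h2 - p 3 * hv
    exact (mul_eq_zero.mp hmul).resolve_right (by linarith)
  have hx : p 0 = 0 := by
    rw [hy0] at h0
    linarith
  have hu : p 1 = 0 := by
    rw [hv] at h1
    linarith
  have hp0 : p = 0 := by
    ext i
    fin_cases i <;> assumption
  exact hp.ne' (by rw [hp0, norm_zero])
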